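/- Let Y be a random variable taking values in [0,∞) with distribution function G having finite moments of all positive integer orders, such that G is absolutely continuous on [x₀,∞) for some x₀ > e, with density g(x) = G′(x) > 0 there. Let a > 0 and α ∈ [0,1). If limsup_{x→∞} g((x + a·(log x)^α + log log x)²) / g(x²) < 1, then G is uniquely determined by its moments among all probability distributions on [0,∞). -/

import Mathlib

open MeasureTheory Filter Set

/-- Moment-determinacy on `ℝ₊` among all probability distributions on `[0,∞)`. -/
def IsMomentDetOnNonneg (μ : Measure ℝ) : Prop :=
  ∀ ν : Measure ℝ, IsProbabilityMeasure ν → ν (Set.Iio 0) = 0 →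
    (∀ n : ℕ, 0 < n → Integrable (fun x => x ^ n) ν ∧
      ∫ x, x ^ n ∂ν = ∫ x, x ^ n ∂μ) → ν = μ

/-- The ratio sequence of the weights `logWeight`. -/
noncomputable def logRatio (n : ℕ) : ℝ := 4 * (n + 1) * Real.log (n + 2)

/-- The sequence `∏_{k < n} 4 (k + 1) log (k + 2)`, comparable to `(n log n)ⁿ`. -/
noncomputable def logWeight (n : ℕ) : ℝ := ∏ k ∈ Finset.range n, logRatio k

theorem half_lt_log (n : ℕ) : 1 / 2 < Real.log (n + 2) := by
  have h1 : Real.log 2 ≤ Real.log (n + 2) :=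
    Real.log_le_log (by norm_num) (by linarith [n.cast_nonneg (α := ℝ)])
  linarith [Real.log_two_gt_d9]

theorem add_one_le_logRatio (n : ℕ) : (n : ℝ) + 1 ≤ logRatio n := by
  have h := half_lt_log n
  have hn : (0 : ℝ) ≤ n := n.cast_nonneg
  unfold logRatio
  nlinarith

theorem logRatio_pos (n : ℕ) : 0 < logRatio n :=
  lt_of_lt_of_le (by positivity) (add_one_le_logRatio n)

theorem logRatio_mono : Monotone logRatio := by
  intro m n h
  have h' : (m : ℝ) ≤ n := by exact_mod_cast h
  have h1 := half_lt_log m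
  have h2 : Real.log (m + 2) ≤ Real.log (n + 2) := Real.log_le_log (by positivity) (by linarith)
  unfold logRatio
  gcongr

theorem logRatio_succ_le (n : ℕ) : logRatio (n + 1) ≤ 4 * logRatio n := by
  have h1 := half_lt_log n
  have hn : (0 : ℝ) ≤ n := n.cast_nonneg
  have h2 : Real.log (((n + 1 : ℕ) : ℝ) + 2) ≤ 2 * Real.log (n + 2) := by
    rw [show (2 : ℝ) = ((2 : ℕ) : ℝ) by norm_num, ← Real.log_pow]
    exact Real.log_le_log (by positivity) (by push_cast; nlinarith)
  have h3 : (((n + 1 : ℕ) : ℝ) + 1) ≤ 2 * (n + 1) := by push_cast; linarith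
  have h4 : 0 ≤ Real.log (((n + 1 : ℕ) : ℝ) + 2) := by linarith [half_lt_log (n + 1)]
  unfold logRatio
  calc 4 * (((n + 1 : ℕ) : ℝ) + 1) * Real.log (((n + 1 : ℕ) : ℝ) + 2)
      ≤ 4 * (2 * (n + 1)) * (2 * Real.log (n + 2)) := by gcongr
    _ = _ := by ring

theorem not_summable_one_div_logRatio : ¬ Summable fun n => 1 / logRatio n := by
  rw [← summable_condensed_iff_of_nonneg (fun n => (one_div_pos.2 (logRatio_pos n)).le)
    (fun m n _ h => one_div_le_one_div_of_le (logRatio_pos m) (logRatio_mono h))]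
  intro hs
  have h2 : Summable fun k : ℕ => 1 / (16 * ((k + 1 : ℕ) : ℝ)) := by
    refine Summable.of_nonneg_of_le (fun k => by positivity) (fun k => ?_) hs
    have hp : (1 : ℝ) ≤ 2 ^ k := one_le_pow₀ (by norm_num)
    have hl : Real.log (((2 ^ k : ℕ) : ℝ) + 2) ≤ 2 * (k + 1) := by
      calc Real.log (((2 ^ k : ℕ) : ℝ) + 2) ≤ Real.log (2 ^ (k + 2)) :=
            Real.log_le_log (by positivity) (by push_cast; rw [pow_add]; linarith)
        _ = (k + 2 : ℕ) * Real.log 2 := Real.log_pow _ _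
        _ ≤ (k + 2 : ℕ) * 1 := by gcongr; linarith [Real.log_two_lt_d9]
        _ ≤ 2 * (k + 1) := by push_cast; linarith [k.cast_nonneg (α := ℝ)]
    have hle : logRatio (2 ^ k) ≤ 2 ^ k * (16 * ((k + 1 : ℕ) : ℝ)) := by
      have h0 : 0 ≤ Real.log (((2 ^ k : ℕ) : ℝ) + 2) := by linarith [half_lt_log (2 ^ k)]
      unfold logRatio
      calc 4 * (((2 ^ k : ℕ) : ℝ) + 1) * Real.log (((2 ^ k : ℕ) : ℝ) + 2)
          ≤ 4 * (2 * 2 ^ k) * (2 * (k + 1)) := by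
            gcongr
            push_cast; linarith
        _ = _ := by push_cast; ring
    rw [mul_one_div, div_le_div_iff₀ (by positivity) (logRatio_pos _)]
    linarith
  have h3 : Summable fun k : ℕ => 1 / ((k + 1 : ℕ) : ℝ) := by
    refine (h2.mul_left 16).congr fun k => ?_
    have : (0 : ℝ) < ((k + 1 : ℕ) : ℝ) := by positivity
    field_simp
  exact Real.not_summable_one_div_natCast ((summable_nat_add_iff 1).1 h3)

theorem logWeight_succ (n : ℕ) : logWeight (n + 1) = logRatio n * logWeight n := by
  rw [logWeight, Finset.prod_range_succ, mul_comm, logWeight]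

theorem factorial_le_logWeight (n : ℕ) : (n.factorial : ℝ) ≤ logWeight n := by
  induction n with
  | zero => simp [logWeight]
  | succ n ih =>
    rw [logWeight_succ, Nat.factorial_succ]
    push_cast
    have := (logRatio_pos n).le
    gcongr
    exact add_one_le_logRatio n

theorem one_le_logWeight (n : ℕ) : 1 ≤ logWeight n :=
  le_trans (by exact_mod_cast n.factorial_pos) (factorial_le_logWeight n)

theorem pow_le_exp_mul_logWeight {x : ℝ} (hx : 0 ≤ x) (n : ℕ) :
    x ^ n ≤ Real.exp x * logWeight n := by
  have h := Real.pow_div_factorial_le_exp x hx n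
  rw [div_le_iff₀ (by positivity)] at h
  exact h.trans (by gcongr; exact factorial_le_logWeight n)

theorem pow_le_exp_div_log_mul_logWeight : ∀ᶠ x : ℝ in atTop, ∀ n : ℕ,
    x ^ n ≤ Real.exp (x / Real.log x) * logWeight n := by
  have hlog : ∀ᶠ x : ℝ in atTop, Real.log x ^ 2 / x ^ (1 / 2 : ℝ) < 1 / 2 := by
    have := (isLittleO_log_rpow_rpow_atTop (s := 1 / 2) 2 (by norm_num)).tendsto_div_nhds_zero
    filter_upwards [this.eventually (gt_mem_nhds (by norm_num : (0 : ℝ) < 1 / 2))] with x hx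
    exact_mod_cast hx
  filter_upwards [hlog, eventually_gt_atTop (Real.exp 1)] with x hx hxe n
  have hx1 : 1 < x := (Real.one_lt_exp_iff.2 one_pos).trans hxe
  have hx0 : 0 < x := by linarith
  have hL : 1 < Real.log x := (Real.lt_log_iff_exp_lt hx0).2 hxe
  rw [← Real.sqrt_eq_rpow, div_lt_iff₀ (Real.sqrt_pos.2 hx0)] at hx
  set L := Real.log x with hLdef
  set s := ⌊√x⌋₊ with hs
  have hss : (s : ℝ) ≤ √x := Nat.floor_le (Real.sqrt_nonneg x)
  have hsq : √x * √x = x := Real.mul_self_sqrt hx0.le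
  have hsL : √x * L ≤ x / (2 * L) := by
    rw [le_div_iff₀ (by positivity)]
    nlinarith [Real.sqrt_nonneg x]
  have hpow : x ^ s ≤ Real.exp (x / (2 * L)) := by
    rw [← Real.exp_log hx0, ← Real.exp_nat_mul, Real.exp_log hx0]
    refine Real.exp_le_exp.2 (le_trans ?_ hsL)
    gcongr
  have htot : x / (2 * L) + x / (2 * L) = x / L := by field_simp; ring
  rcases le_total n s with hns | hns
  · calc x ^ n ≤ x ^ s := pow_le_pow_right₀ hx1.le hns
      _ ≤ Real.exp (x / L) := hpow.trans (Real.exp_le_exp.2 (by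
          rw [← htot]; exact le_add_of_nonneg_right (by positivity)))
      _ ≤ _ := le_mul_of_one_le_right (Real.exp_pos _).le (one_le_logWeight n)
  · obtain ⟨m, rfl⟩ := Nat.exists_eq_add_of_le hns
    have hW : ∀ m : ℕ, (m.factorial : ℝ) * (2 * L) ^ m ≤ logWeight (s + m) := by
      intro m
      induction m with
      | zero => simpa using one_le_logWeight s
      | succ m ih =>
        rw [← add_assoc, logWeight_succ, Nat.factorial_succ]
        have hr : ((m : ℝ) + 1) * (2 * L) ≤ logRatio (s + m) := by
          have h1 : L / 2 ≤ Real.log (((s + m : ℕ) : ℝ) + 2) := by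
            rw [← Real.log_sqrt hx0.le]
            refine Real.log_le_log (Real.sqrt_pos.2 hx0) ?_
            have := Nat.lt_floor_add_one (√x)
            push_cast
            linarith [m.cast_nonneg (α := ℝ)]
          unfold logRatio
          calc ((m : ℝ) + 1) * (2 * L) = 4 * (m + 1) * (L / 2) := by ring
            _ ≤ _ := by
              gcongr
              exact Nat.le_add_left m s
        calc (((m + 1) * m.factorial : ℕ) : ℝ) * (2 * L) ^ (m + 1)
            = ((m + 1) * (2 * L)) * (m.factorial * (2 * L) ^ m) := by push_cast; ring
          _ ≤ _ := by
            have := (logRatio_pos (s + m)).le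
            gcongr
    have hm : x ^ m ≤ Real.exp (x / (2 * L)) * logWeight (s + m) := by
      have h := Real.pow_div_factorial_le_exp (x / (2 * L)) (by positivity) m
      rw [div_le_iff₀ (by positivity), div_pow, div_le_iff₀ (by positivity), mul_assoc] at h
      exact h.trans (by gcongr; exact hW m)
    calc x ^ (s + m) = x ^ s * x ^ m := pow_add _ _ _
      _ ≤ Real.exp (x / (2 * L)) * (Real.exp (x / (2 * L)) * logWeight (s + m)) := by gcongr
      _ = _ := by rw [← mul_assoc, ← Real.exp_add, htot]

theorem bang_step {D : ℕ → ℝ → ℝ} {M r : ℕ → ℝ} (hD : ∀ n x, HasDerivAt (D n) (D (n + 1) x) x)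
    (hM : ∀ n, 0 ≤ M n) (hr : ∀ n, 0 < r n) (hr_mono : Monotone r)
    (hMr : ∀ n, M (n + 1) = r n * M n) (hb : ∀ n x, |D n x| ≤ M n) {N : ℕ} {x : ℝ}
    (hx : ∀ n ≤ N + 1, |D n x| ≤ Real.exp ((n : ℝ) - (N + 1)) * M n) {h : ℝ} (hh0 : 0 ≤ h)
    (hh : h ≤ 1 / (Real.exp 1 * r N)) {n : ℕ} (hn : n ≤ N) :
    |D n (x + h)| ≤ Real.exp ((n : ℝ) - N) * M n := by
  set c := Real.exp 1 * r N with hc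
  have hcpos : 0 < c := mul_pos (Real.exp_pos _) (hr N)
  have key : ∀ n ≤ N + 1, ∀ s, 0 ≤ s →
      |D n (x + s)| ≤ Real.exp ((n : ℝ) - (N + 1)) * M n * Real.exp (c * s) := by
    intro n hn
    induction hn using Nat.decreasingInduction with
    | self =>
      intro s hs
      refine (hb _ _).trans ?_
      have : 1 ≤ Real.exp (c * s) := Real.one_le_exp (by positivity)
      simpa using le_mul_of_one_le_right (hM (N + 1)) this
    | of_succ n hn ih =>
      intro s hs
      have hderiv : ∀ t, HasDerivAt (fun t => D n (x + t)) (D (n + 1) (x + t)) t := fun t => by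
        simpa using (hD n (x + t)).comp_const_add x t
      refine image_norm_le_of_norm_deriv_right_le_deriv_boundary (a := 0) (b := s)
        (f := fun t => D n (x + t)) (f' := fun t => D (n + 1) (x + t))
        (B := fun t => Real.exp ((n : ℝ) - (N + 1)) * M n * Real.exp (c * t))
        (B' := fun t => Real.exp ((n : ℝ) - (N + 1)) * M n * (Real.exp (c * t) * c))
        (fun t _ => (hderiv t).continuousAt.continuousWithinAt)
        (fun t _ => (hderiv t).hasDerivWithinAt) ?_ ?_ ?_ ⟨hs, le_rfl⟩
      · simpa using hx n (by lia)
      · intro t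
        have := ((hasDerivAt_id t).const_mul c).exp.const_mul (Real.exp ((n : ℝ) - (N + 1)) * M n)
        simpa using this
      · intro t ht
        refine (ih t ht.1).trans ?_
        have e1 : Real.exp (((n + 1 : ℕ) : ℝ) - (N + 1))
            = Real.exp ((n : ℝ) - (N + 1)) * Real.exp 1 := by
          rw [← Real.exp_add]; push_cast; ring_nf
        have e2 : r n ≤ r N := hr_mono (by lia)
        rw [e1, hMr, hc]
        have hMn := hM n
        calc _ = Real.exp ((n : ℝ) - (N + 1)) * Real.exp 1 * M n * Real.exp (c * t) * r n := by
              rw [hc]; ring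
          _ ≤ Real.exp ((n : ℝ) - (N + 1)) * Real.exp 1 * M n * Real.exp (c * t) * r N := by
              gcongr
          _ = _ := by rw [hc]; ring
  refine (key n (by lia) h hh0).trans ?_
  have h1 : c * h ≤ 1 := by
    rw [le_div_iff₀ hcpos] at hh
    linarith
  have hMn := hM n
  calc _ ≤ Real.exp ((n : ℝ) - (N + 1)) * M n * Real.exp 1 := by gcongr
    _ = Real.exp ((n : ℝ) - N) * M n := by
      rw [mul_right_comm, ← Real.exp_add]; ring_nf

/-- Bang's form of the Denjoy–Carleman theorem on the half-line: a function whose successive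
derivatives `D n` are bounded by a log-convex sequence `M n` with non-summable inverse ratios and
vanish at `0` is zero. -/
theorem eq_zero_of_quasianalytic {D : ℕ → ℝ → ℝ} {M r : ℕ → ℝ}
    (hD : ∀ n x, HasDerivAt (D n) (D (n + 1) x) x)
    (hM : ∀ n, 0 ≤ M n) (hr : ∀ n, 0 < r n) (hr_mono : Monotone r)
    (hMr : ∀ n, M (n + 1) = r n * M n) (hb : ∀ n x, |D n x| ≤ M n)
    (hsum : ¬ Summable fun n => 1 / r n) (h0 : ∀ n, D n 0 = 0) {y : ℝ} (hy : 0 ≤ y) :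
    D 0 y = 0 := by
  have key : ∀ d K : ℕ, ∀ y, 0 ≤ y →
      y ≤ ∑ i ∈ Finset.range d, 1 / (Real.exp 1 * r (K + i)) →
      ∀ n ≤ K, |D n y| ≤ Real.exp ((n : ℝ) - K) * M n := by
    intro d
    induction d with
    | zero =>
      intro K y hy0 hy n _
      have : y = 0 := le_antisymm (by simpa using hy) hy0
      rw [this, h0, abs_zero]
      exact mul_nonneg (Real.exp_pos _).le (hM n)
    | succ d ih =>
      intro K y hy0 hy n hn
      rw [Finset.sum_range_succ'] at hy
      set S := ∑ i ∈ Finset.range d, 1 / (Real.exp 1 * r (K + 1 + i)) with hS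
      have hS' : ∑ i ∈ Finset.range d, 1 / (Real.exp 1 * r (K + (i + 1))) = S :=
        Finset.sum_congr rfl fun i _ => by rw [add_assoc, add_comm 1 i]
      rw [hS', add_zero] at hy
      have hS0 : 0 ≤ S := Finset.sum_nonneg fun i _ => by
        have := hr (K + 1 + i); positivity
      have hp : 0 ≤ 1 / (Real.exp 1 * r K) := by have := hr K; positivity
      have := bang_step hD hM hr hr_mono hMr hb (N := K) (x := min y S)
        (fun n hn => by simpa using ih (K + 1) (min y S) (le_min hy0 hS0) (min_le_right _ _) n hn)
        (h := y - min y S) (sub_nonneg.2 (min_le_left _ _))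
        (by rcases min_cases y S with h | h <;> linarith) hn
      simpa using this
  have hbound : ∀ K : ℕ, |D 0 y| ≤ Real.exp (-(K : ℝ)) * M 0 := by
    intro K
    have hns : ¬ Summable fun i => 1 / (Real.exp 1 * r (K + i)) := by
      intro hs
      apply hsum
      rw [← summable_nat_add_iff K]
      refine (hs.mul_left (Real.exp 1)).congr fun i => ?_
      have := hr (K + i)
      rw [add_comm i K]
      field_simp
    have ht := (not_summable_iff_tendsto_nat_atTop_of_nonneg (fun i => by
      have := hr (K + i); positivity)).1 hns
    obtain ⟨d, hd⟩ := (ht.eventually_ge_atTop y).exists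
    simpa using key d K y hy hd 0 (Nat.zero_le K)
  have hlim : Tendsto (fun K : ℕ => Real.exp (-(K : ℝ)) * M 0) atTop (nhds 0) := by
    simpa using (Real.tendsto_exp_neg_atTop_nhds_zero.comp
      tendsto_natCast_atTop_atTop).mul_const (M 0)
  exact abs_nonpos_iff.1 (ge_of_tendsto' hlim hbound)

theorem sqrt_pow_le (y : ℝ) (n : ℕ) : √y ^ n ≤ 1 + |y ^ n| := by
  rcases le_total (√y) 1 with h | h
  · linarith [pow_le_one₀ (n := n) (Real.sqrt_nonneg y) h, abs_nonneg (y ^ n)]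
  · have hy : 0 < y := Real.sqrt_pos.1 (by linarith)
    have h2 : √y ≤ y := by nlinarith [Real.mul_self_sqrt hy.le]
    have h3 : √y ^ n ≤ y ^ n := pow_le_pow_left₀ (Real.sqrt_nonneg y) h2 n
    linarith [le_abs_self (y ^ n)]

theorem integrable_sqrt_pow {μ : Measure ℝ} [IsFiniteMeasure μ]
    (h : ∀ n : ℕ, Integrable (fun x => x ^ n) μ) (n : ℕ) : Integrable (fun x => √x ^ n) μ := by
  refine Integrable.mono' ((integrable_const (1 : ℝ)).add (h n).abs)
    (by fun_prop) (ae_of_all _ fun y => ?_)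
  rw [Real.norm_of_nonneg (by positivity)]
  exact sqrt_pow_le y n

theorem integrable_sqrt_pow_mul_cos {μ : Measure ℝ} [IsFiniteMeasure μ]
    (h : ∀ n : ℕ, Integrable (fun x => x ^ n) μ) (n : ℕ) (t c : ℝ) :
    Integrable (fun x => √x ^ n * Real.cos (t * √x + c)) μ := by
  refine Integrable.mono' (integrable_sqrt_pow h n) (by fun_prop) (ae_of_all _ fun y => ?_)
  rw [norm_mul, Real.norm_of_nonneg (by positivity)]
  exact mul_le_of_le_one_right (by positivity) (Real.abs_cos_le_one _)

theorem abs_integral_sqrt_pow_mul_cos_le {μ : Measure ℝ} [IsFiniteMeasure μ]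
    (h : ∀ n : ℕ, Integrable (fun x => x ^ n) μ) (n : ℕ) (t c : ℝ) :
    |∫ x, √x ^ n * Real.cos (t * √x + c) ∂μ| ≤ ∫ x, √x ^ n ∂μ := by
  rw [← Real.norm_eq_abs]
  refine norm_integral_le_of_norm_le (integrable_sqrt_pow h n) (ae_of_all _ fun y => ?_)
  rw [norm_mul, Real.norm_of_nonneg (by positivity)]
  exact mul_le_of_le_one_right (by positivity) (Real.abs_cos_le_one _)

theorem hasDerivAt_integral_sqrt_pow_mul_cos {μ : Measure ℝ} [IsFiniteMeasure μ]
    (h : ∀ n : ℕ, Integrable (fun x => x ^ n) μ) (n : ℕ) (t : ℝ) :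
    HasDerivAt (fun t => ∫ x, √x ^ n * Real.cos (t * √x + n * (Real.pi / 2)) ∂μ)
      (∫ x, √x ^ (n + 1) * Real.cos (t * √x + (n + 1 : ℕ) * (Real.pi / 2)) ∂μ) t := by
  refine (hasDerivAt_integral_of_dominated_loc_of_deriv_le (s := univ)
    (F := fun t x => √x ^ n * Real.cos (t * √x + n * (Real.pi / 2)))
    (F' := fun t x => √x ^ (n + 1) * Real.cos (t * √x + (n + 1 : ℕ) * (Real.pi / 2)))
    (bound := fun x => √x ^ (n + 1)) univ_mem
    (Eventually.of_forall fun s => (integrable_sqrt_pow_mul_cos h n s _).aestronglyMeasurable)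
    (integrable_sqrt_pow_mul_cos h n t _)
    (integrable_sqrt_pow_mul_cos h (n + 1) t _).aestronglyMeasurable
    (ae_of_all _ fun y s _ => ?_) (integrable_sqrt_pow h (n + 1))
    (ae_of_all _ fun y s _ => ?_)).2
  · rw [norm_mul, Real.norm_of_nonneg (by positivity)]
    exact mul_le_of_le_one_right (by positivity) (Real.abs_cos_le_one _)
  · have e : Real.cos (s * √y + (n + 1 : ℕ) * (Real.pi / 2))
        = -Real.sin (s * √y + n * (Real.pi / 2)) := by
      rw [← Real.cos_add_pi_div_two]; push_cast; ring_nf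
    rw [e]
    have := ((((hasDerivAt_id s).mul_const (√y)).add_const
      (n * (Real.pi / 2))).cos).const_mul (√y ^ n)
    refine this.congr_deriv ?_
    rw [id]
    ring

theorem integral_cexp_add_integral_cexp_neg {μ : Measure ℝ} [IsFiniteMeasure μ] (t : ℝ) :
    (∫ x, Complex.exp (t * (√x : ℝ) * Complex.I) ∂μ)
      + ∫ x, Complex.exp (t * (-√x : ℝ) * Complex.I) ∂μ
      = ((2 * ∫ x, Real.cos (t * √x) ∂μ : ℝ) : ℂ) := by
  have hint : ∀ f : ℝ → ℝ, Measurable f →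
      Integrable (fun x => Complex.exp (t * (f x : ℝ) * Complex.I)) μ := by
    intro f hf
    refine Integrable.mono' (integrable_const (1 : ℝ)) (by fun_prop) (ae_of_all _ fun y => ?_)
    rw [← Complex.ofReal_mul, Complex.norm_exp_ofReal_mul_I]
  rw [← integral_add (hint _ (by fun_prop)) (hint _ (by fun_prop)), ← integral_const_mul,
    ← integral_complex_ofReal]
  refine integral_congr_ae (ae_of_all _ fun y => ?_)
  simp only
  push_cast
  rw [Complex.two_cos]
  ring_nf

theorem ext_of_integral_cos_sqrt {μ ν : Measure ℝ} [IsFiniteMeasure μ] [IsFiniteMeasure ν]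
    (hμ : μ (Iio 0) = 0) (hν : ν (Iio 0) = 0)
    (h : ∀ t, 0 ≤ t → ∫ x, Real.cos (t * √x) ∂μ = ∫ x, Real.cos (t * √x) ∂ν) : ν = μ := by
  have hall : ∀ t, ∫ x, Real.cos (t * √x) ∂μ = ∫ x, Real.cos (t * √x) ∂ν := by
    intro t
    have := h |t| (abs_nonneg t)
    have e : ∀ x, Real.cos (|t| * √x) = Real.cos (t * √x) := fun x => by
      rw [← Real.cos_abs (t * √x), abs_mul, abs_of_nonneg (Real.sqrt_nonneg x)]
    simpa only [e] using this
  let sym : Measure ℝ → Measure ℝ := fun m => m.map (fun x => √x) + m.map (fun x => -√x)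
  have hchar : ∀ m : Measure ℝ, IsFiniteMeasure m → ∀ t,
      charFun (sym m) t = ((2 * ∫ x, Real.cos (t * √x) ∂m : ℝ) : ℂ) := by
    intro m hm t
    rw [← integral_cexp_add_integral_cexp_neg, charFun_apply_real]
    have hint : ∀ m : Measure ℝ, IsFiniteMeasure m →
        Integrable (fun x : ℝ => Complex.exp (t * x * Complex.I)) m := by
      intro m hm
      refine Integrable.mono' (integrable_const (1 : ℝ)) (by fun_prop) (ae_of_all _ fun y => ?_)
      rw [← Complex.ofReal_mul, Complex.norm_exp_ofReal_mul_I]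
    rw [integral_add_measure (hint _ inferInstance) (hint _ inferInstance),
      integral_map (by fun_prop) (by fun_prop), integral_map (by fun_prop) (by fun_prop)]
  have hsym : sym μ = sym ν := by
    apply Measure.ext_of_charFun
    ext t
    rw [hchar μ inferInstance, hchar ν inferInstance, hall]
  have hsq : ∀ m : Measure ℝ, m (Iio 0) = 0 → (sym m).map (fun x => x ^ 2) = m + m := by
    intro m hm
    have hae : (fun x => √x ^ 2) =ᵐ[m] id := by
      have : ∀ᵐ x ∂m, x ∉ Iio (0 : ℝ) := measure_eq_zero_iff_ae_notMem.1 hm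
      filter_upwards [this] with x hx
      exact Real.sq_sqrt (not_lt.1 hx)
    have e1 : (fun x : ℝ => x ^ 2) ∘ (fun x => √x) = fun x => √x ^ 2 := rfl
    have e2 : (fun x : ℝ => x ^ 2) ∘ (fun x => -√x) = fun x => √x ^ 2 := by
      ext x; simp
    rw [Measure.map_add _ _ (by fun_prop), Measure.map_map (by fun_prop) (by fun_prop),
      Measure.map_map (by fun_prop) (by fun_prop), e1, e2, Measure.map_congr hae, Measure.map_id]
  have htwo : μ + μ = ν + ν := by rw [← hsq μ hμ, ← hsq ν hν, hsym]
  ext s _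
  have hs : μ s + μ s = ν s + ν s := by
    simpa using congrArg (fun m : Measure ℝ => m s) htwo
  rw [← two_mul, ← two_mul] at hs
  exact ((ENNReal.mul_right_inj two_ne_zero ENNReal.ofNat_ne_top).1 hs).symm

/-- An explicit Carleman-type criterion: moments `E[Y^{n/2}]` of order `(n log n)ⁿ`
force determinacy. -/
theorem isMomentDetOnNonneg_of_sqrt_moment_le {μ : Measure ℝ} [IsProbabilityMeasure μ]
    (hsupp : μ (Iio 0) = 0) (hmom : ∀ n : ℕ, Integrable (fun x => x ^ n) μ) {C : ℝ}
    (hC : ∀ n : ℕ, ∫ x, √x ^ n ∂μ ≤ C * logWeight n) : IsMomentDetOnNonneg μ := by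
  intro ν hν hνsupp hνμ
  have hνmom : ∀ n : ℕ, Integrable (fun x => x ^ n) ν := by
    intro n
    rcases n.eq_zero_or_pos with rfl | hn
    · simp
    · exact (hνμ n hn).1
  have hC0 : 0 ≤ C := by
    have := (integral_nonneg (μ := μ) fun x : ℝ => pow_nonneg (Real.sqrt_nonneg x) 0).trans (hC 0)
    simpa [logWeight] using this
  have heven : ∀ k : ℕ, ∫ x, √x ^ (2 * k) ∂ν = ∫ x, √x ^ (2 * k) ∂μ := by
    have e : ∀ m : Measure ℝ, m (Iio 0) = 0 → ∀ k : ℕ,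
        ∫ x, √x ^ (2 * k) ∂m = ∫ x, x ^ k ∂m := by
      intro m hm k
      refine integral_congr_ae ?_
      have : ∀ᵐ x ∂m, x ∉ Iio (0 : ℝ) := measure_eq_zero_iff_ae_notMem.1 hm
      filter_upwards [this] with x hx
      rw [pow_mul, Real.sq_sqrt (not_lt.1 hx)]
    intro k
    rw [e ν hνsupp, e μ hsupp]
    rcases k.eq_zero_or_pos with rfl | hk
    · simp
    · exact (hνμ k hk).2
  have hνC : ∀ n : ℕ, ∫ x, √x ^ n ∂ν ≤ 5 * C * logWeight n := by
    intro n
    have hw := one_le_logWeight n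
    rcases Nat.even_or_odd' n with ⟨k, rfl | rfl⟩
    · rw [heven]
      exact (hC _).trans (by gcongr; linarith)
    · set r := logRatio (2 * k) with hr
      have hrpos : 0 < r := logRatio_pos _
      have hle : ∀ x : ℝ, √x ^ (2 * k + 1) ≤ r * √x ^ (2 * k) + r⁻¹ * √x ^ (2 * (k + 1)) := by
        intro x
        have hx : √x ≤ r + r⁻¹ * √x ^ 2 := by
          have : √x * r ≤ r * r + √x ^ 2 := by nlinarith [sq_nonneg (√x - r), Real.sqrt_nonneg x]
          calc √x = √x * r * r⁻¹ := by field_simp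
            _ ≤ (r * r + √x ^ 2) * r⁻¹ := by gcongr
            _ = _ := by field_simp
        calc √x ^ (2 * k + 1) = √x ^ (2 * k) * √x := pow_succ _ _
          _ ≤ √x ^ (2 * k) * (r + r⁻¹ * √x ^ 2) := by gcongr
          _ = _ := by ring
      have i1 := (integrable_sqrt_pow hνmom (2 * k)).const_mul r
      have i2 := (integrable_sqrt_pow hνmom (2 * (k + 1))).const_mul r⁻¹
      have hr2 : logRatio (2 * k + 1) ≤ 4 * r := logRatio_succ_le _
      have hw' := one_le_logWeight (2 * k)
      calc ∫ x, √x ^ (2 * k + 1) ∂ν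
          ≤ ∫ x, (r * √x ^ (2 * k) + r⁻¹ * √x ^ (2 * (k + 1))) ∂ν :=
            integral_mono (integrable_sqrt_pow hνmom _) (i1.add i2) hle
        _ = r * ∫ x, √x ^ (2 * k) ∂μ + r⁻¹ * ∫ x, √x ^ (2 * (k + 1)) ∂μ := by
            rw [integral_add i1 i2, integral_const_mul, integral_const_mul, heven, heven]
        _ ≤ r * (C * logWeight (2 * k)) + r⁻¹ * (C * logWeight (2 * (k + 1))) := by
            gcongr
            · exact hC _
            · exact hC _
        _ = r * (C * logWeight (2 * k))
              + C * logWeight (2 * k) * logRatio (2 * k + 1) := by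
            rw [show 2 * (k + 1) = 2 * k + 1 + 1 by ring, logWeight_succ, logWeight_succ, ← hr]
            field_simp
        _ ≤ r * (C * logWeight (2 * k)) + C * logWeight (2 * k) * (4 * r) := by gcongr
        _ = 5 * C * logWeight (2 * k + 1) := by rw [logWeight_succ]; ring
  let D : ℕ → ℝ → ℝ := fun n t =>
    (∫ x, √x ^ n * Real.cos (t * √x + n * (Real.pi / 2)) ∂μ)
      - ∫ x, √x ^ n * Real.cos (t * √x + n * (Real.pi / 2)) ∂ν
  have hD0 : ∀ n, D n 0 = 0 := by
    intro n
    simp only [D, zero_mul, zero_add, integral_mul_const]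
    rcases Nat.even_or_odd' n with ⟨k, rfl | rfl⟩
    · rw [heven, sub_self]
    · have : Real.cos (((2 * k + 1 : ℕ) : ℝ) * (Real.pi / 2)) = 0 :=
        Real.cos_eq_zero_iff.2 ⟨k, by push_cast; ring⟩
      rw [this, mul_zero, mul_zero, sub_self]
  have hzero : ∀ t, 0 ≤ t → D 0 t = 0 := by
    intro t ht
    refine eq_zero_of_quasianalytic (D := D) (M := fun n => 6 * C * logWeight n) (r := logRatio)
      (fun n x => (hasDerivAt_integral_sqrt_pow_mul_cos hmom n x).sub
        (hasDerivAt_integral_sqrt_pow_mul_cos hνmom n x))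
      (fun n => by have := one_le_logWeight n; positivity) logRatio_pos logRatio_mono
      (fun n => by rw [logWeight_succ]; ring) (fun n x => ?_) not_summable_one_div_logRatio hD0 ht
    calc |D n x| ≤ _ := abs_sub _ _
      _ ≤ C * logWeight n + 5 * C * logWeight n :=
        add_le_add ((abs_integral_sqrt_pow_mul_cos_le hmom n x _).trans (hC n))
          ((abs_integral_sqrt_pow_mul_cos_le hνmom n x _).trans (hνC n))
      _ = _ := by ring
  refine ext_of_integral_cos_sqrt hsupp hνsupp fun t ht => ?_
  simpa [D, sub_eq_zero] using hzero t ht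

/-- If `g ∘ S` is small compared with `g`, where `S` is an increasing bijection between half-lines,
then functions growing slowly along `S` have finite integral against the tail with density `g`. -/
theorem setLIntegral_Ici_lt_top_of_contraction {μ : Measure ℝ} [IsProbabilityMeasure μ]
    {g Φ S S' w : ℝ → ℝ} {b κ B : ℝ} (hg : Measurable g) (hΦ : Measurable Φ)
    (hdens : μ.restrict (Ici b) =
      (volume.restrict (Ici b)).withDensity fun x => ENNReal.ofReal (g x))
    (hg0 : ∀ y ∈ Ici b, 0 ≤ g y) (hΦ0 : ∀ y, 0 ≤ Φ y)
    (hS : ∀ y ∈ Ici b, HasDerivAt S (S' y) y) (hS_mono : StrictMonoOn S (Ici b))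
    (hS_top : Tendsto S atTop atTop) (hbS : b ≤ S b)
    (hw : ∀ y ∈ Ici b, 1 ≤ w y) (hΦS : ∀ y ∈ Ici b, Φ (S y) ≤ w y * Φ y)
    (hκ : κ < 1) (hκ0 : 0 ≤ κ) (hgS : ∀ y ∈ Ici b, w y * (|S' y| * g (S y)) ≤ κ * g y)
    (hB : ∀ y ∈ Icc b (S b), Φ y ≤ B) :
    ∫⁻ y in Ici b, ENNReal.ofReal (Φ y) ∂μ < ⊤ := by
  have hdens' : ∀ s ⊆ Ici b, MeasurableSet s → ∀ f : ℝ → ENNReal, Measurable f →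
      ∫⁻ y in s, f y ∂μ = ∫⁻ y in s, ENNReal.ofReal (g y) * f y := by
    intro s hs hsm f hf
    have h1 : μ.restrict s = (volume.restrict s).withDensity fun x => ENNReal.ofReal (g x) := by
      rw [← Measure.restrict_restrict_of_subset hs, hdens, restrict_withDensity hsm,
        Measure.restrict_restrict_of_subset hs]
    rw [h1, lintegral_withDensity_eq_lintegral_mul _ (by fun_prop) hf]
    rfl
  have hScont : ContinuousOn S (Ici b) := fun y hy => (hS y hy).continuousAt.continuousWithinAt
  have himg : S '' Ici b = Ici (S b) := subset_antisymm
    hS_mono.monotoneOn.image_Ici_subset (intermediate_value_Ici hScont hS_top)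
  have htrunc : ∀ N : ℕ, ∫⁻ y in Ici b, ENNReal.ofReal (min (Φ y) N) ∂μ
      ≤ ENNReal.ofReal B / (1 - ENNReal.ofReal κ) := by
    intro N
    set F : ℝ → ENNReal := fun y => ENNReal.ofReal (min (Φ y) N) with hF
    have hFm : Measurable F := by fun_prop
    set I := ∫⁻ y in Ici b, F y ∂μ with hI
    have hItop : I ≠ ⊤ := by
      have : I ≤ ∫⁻ _ in Ici b, ENNReal.ofReal N ∂μ :=
        lintegral_mono fun y => ENNReal.ofReal_le_ofReal (min_le_right _ _)
      refine ne_top_of_le_ne_top ?_ this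
      rw [setLIntegral_const]
      exact ENNReal.mul_ne_top ENNReal.ofReal_ne_top (measure_ne_top _ _)
    have hsplit : I ≤ (∫⁻ y in Icc b (S b), F y ∂μ) + ∫⁻ y in Ici (S b), F y ∂μ := by
      rw [hI]
      refine (lintegral_mono_set ?_).trans (lintegral_union_le F (Icc b (S b)) (Ici (S b)))
      exact fun y hy => (le_total y (S b)).imp (fun h => ⟨hy, h⟩) id
    have h1 : ∫⁻ y in Icc b (S b), F y ∂μ ≤ ENNReal.ofReal B := by
      calc ∫⁻ y in Icc b (S b), F y ∂μ ≤ ∫⁻ _ in Icc b (S b), ENNReal.ofReal B ∂μ :=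
            setLIntegral_mono measurable_const fun y hy =>
              ENNReal.ofReal_le_ofReal ((min_le_left _ _).trans (hB y hy))
        _ = ENNReal.ofReal B * μ (Icc b (S b)) := setLIntegral_const _ _
        _ ≤ ENNReal.ofReal B * 1 := by gcongr; exact prob_le_one
        _ = _ := mul_one _
    have h2 : ∫⁻ y in Ici (S b), F y ∂μ ≤ ENNReal.ofReal κ * I := by
      rw [hdens' _ (Ici_subset_Ici.2 hbS) measurableSet_Ici F hFm, ← himg,
        lintegral_image_eq_lintegral_abs_deriv_mul measurableSet_Ici
          (fun y hy => (hS y hy).hasDerivWithinAt) hS_mono.injOn,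
        hI, hdens' _ subset_rfl measurableSet_Ici F hFm, ← lintegral_const_mul _ (by fun_prop)]
      refine setLIntegral_mono (by fun_prop) fun y hy => ?_
      have hSy : S y ∈ Ici b := hbS.trans (hS_mono.monotoneOn self_mem_Ici hy hy)
      have hmin0 : 0 ≤ min (Φ y) (N : ℝ) := le_min (hΦ0 y) N.cast_nonneg
      have hwy := hw y hy
      have hmin : min (Φ (S y)) (N : ℝ) ≤ w y * min (Φ y) N := by
        rw [mul_min_of_nonneg _ _ (by linarith)]
        exact min_le_min (hΦS y hy) (le_mul_of_one_le_left N.cast_nonneg hwy)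
      have hgSy := hg0 _ hSy
      rw [hF]
      simp only
      rw [← ENNReal.ofReal_mul hgSy, ← ENNReal.ofReal_mul (abs_nonneg _),
        ← ENNReal.ofReal_mul (hg0 y hy), ← ENNReal.ofReal_mul hκ0]
      refine ENNReal.ofReal_le_ofReal ?_
      calc |S' y| * (g (S y) * min (Φ (S y)) N) ≤ |S' y| * (g (S y) * (w y * min (Φ y) N)) := by
            gcongr
        _ = w y * (|S' y| * g (S y)) * min (Φ y) N := by ring
        _ ≤ κ * g y * min (Φ y) N := mul_le_mul_of_nonneg_right (hgS y hy) hmin0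
        _ = _ := by ring
    have hle : I ≤ ENNReal.ofReal B + ENNReal.ofReal κ * I := hsplit.trans (add_le_add h1 h2)
    have hκ1 : ENNReal.ofReal κ < 1 := by simpa using hκ
    rw [ENNReal.le_div_iff_mul_le (Or.inl (tsub_pos_of_lt hκ1).ne')
      (Or.inl (ne_top_of_le_ne_top ENNReal.one_ne_top tsub_le_self)),
      ENNReal.mul_sub (fun _ _ => hItop), mul_one, mul_comm]
    exact tsub_le_iff_right.2 hle
  have hsup : ∀ y, ENNReal.ofReal (Φ y) = ⨆ N : ℕ, ENNReal.ofReal (min (Φ y) N) := by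
    intro y
    refine le_antisymm ?_ (iSup_le fun N => ENNReal.ofReal_le_ofReal (min_le_left _ _))
    obtain ⟨N, hN⟩ := exists_nat_ge (Φ y)
    exact le_iSup_of_le N (by rw [min_eq_left hN])
  simp_rw [hsup]
  rw [lintegral_iSup (f := fun (N : ℕ) y => ENNReal.ofReal (min (Φ y) N)) (fun N => by fun_prop) fun m n h y =>
    ENNReal.ofReal_le_ofReal (min_le_min le_rfl (by exact_mod_cast h))]
  refine (iSup_le htrunc).trans_lt (ENNReal.div_lt_top ENNReal.ofReal_ne_top ?_)
  exact (tsub_pos_of_lt (by simpa using hκ)).ne'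

/-- The increment `a (log x)^α + log log x`. -/
noncomputable def logStep (a α x : ℝ) : ℝ := a * Real.log x ^ α + Real.log (Real.log x)

theorem logStep_monotoneOn {a α : ℝ} (ha : 0 ≤ a) (hα : 0 ≤ α) :
    MonotoneOn (logStep a α) (Ici (Real.exp 1)) := by
  intro x hx y _ hxy
  have hx0 : 0 < x := (Real.exp_pos 1).trans_le hx
  have h1 : 1 ≤ Real.log x := (Real.le_log_iff_exp_le hx0).2 hx
  have h2 : Real.log x ≤ Real.log y := Real.log_le_log hx0 hxy
  unfold logStep
  gcongr

theorem logStep_nonneg {a α x : ℝ} (ha : 0 ≤ a) (hx : Real.exp 1 ≤ x) : 0 ≤ logStep a α x := by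
  have h1 : 1 ≤ Real.log x := (Real.le_log_iff_exp_le ((Real.exp_pos 1).trans_le hx)).2 hx
  have := Real.log_nonneg h1
  unfold logStep
  positivity

theorem hasDerivAt_logStep {a α x : ℝ} (hx : Real.exp 1 ≤ x) :
    HasDerivAt (logStep a α)
      ((a * (α * Real.log x ^ (α - 1)) + (Real.log x)⁻¹) * x⁻¹) x := by
  have hx0 : 0 < x := (Real.exp_pos 1).trans_le hx
  have h1 : 1 ≤ Real.log x := (Real.le_log_iff_exp_le hx0).2 hx
  have hl := Real.hasDerivAt_log hx0.ne'
  have := ((hl.rpow_const (p := α) (Or.inl (by linarith))).const_mul a).add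
    (hl.log (by linarith))
  refine this.congr_deriv ?_
  ring

theorem tendsto_logStep_div_log {a α : ℝ} (hα : α < 1) :
    Tendsto (fun x => logStep a α x / Real.log x) atTop (nhds 0) := by
  have h1 : Tendsto (fun L : ℝ => a * L ^ (-(1 - α)) + Real.log L / L) atTop (nhds 0) := by
    have := ((tendsto_rpow_neg_atTop (sub_pos.2 hα)).const_mul a).add
      Real.isLittleO_log_id_atTop.tendsto_div_nhds_zero
    simpa using this
  refine (h1.comp Real.tendsto_log_atTop).congr' ?_
  filter_upwards [Real.tendsto_log_atTop.eventually_gt_atTop 0] with x hx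
  simp only [Function.comp, logStep]
  rw [neg_sub, Real.rpow_sub_one hx.ne']
  ring

theorem tendsto_logStep_div {a α : ℝ} (hα : α < 1) :
    Tendsto (fun x => logStep a α x / x) atTop (nhds 0) := by
  have h := (tendsto_logStep_div_log (a := a) hα).mul
    Real.isLittleO_log_id_atTop.tendsto_div_nhds_zero
  rw [mul_zero] at h
  refine h.congr' ?_
  filter_upwards [Real.tendsto_log_atTop.eventually_gt_atTop 0] with x hx
  simp only [id]
  field_simp

theorem tendsto_deriv_logStep {a α : ℝ} (hα : α < 1) :
    Tendsto (fun x => (a * (α * Real.log x ^ (α - 1)) + (Real.log x)⁻¹) * x⁻¹) atTop (nhds 0) := by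
  have h1 : Tendsto (fun L : ℝ => a * (α * L ^ (-(1 - α))) + L⁻¹) atTop (nhds 0) := by
    have := (((tendsto_rpow_neg_atTop (sub_pos.2 hα)).const_mul α).const_mul a).add
      tendsto_inv_atTop_zero
    simpa using this
  have := (h1.comp Real.tendsto_log_atTop).mul tendsto_inv_atTop_zero
  simpa [Function.comp_def, neg_sub] using this

/-- Under the ratio condition the tail of `μ` integrates `exp (√y / log √y)`. -/
theorem exists_lintegral_exp_sqrt_div_log_lt_top {x₀ a α : ℝ} (ha : 0 < a)
    (hα : α ∈ Ico (0 : ℝ) 1) {μ : Measure ℝ} [IsProbabilityMeasure μ] {g : ℝ → ℝ}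
    (hg_meas : Measurable g)
    (hg_ac : μ.restrict (Ici x₀) =
      (volume.restrict (Ici x₀)).withDensity (fun x => ENNReal.ofReal (g x)))
    (hg_pos : ∀ x ∈ Ici x₀, 0 < g x) {ρ : ℝ} (hρ : ρ < 1) (hρ0 : 0 ≤ ρ)
    (hratio : ∀ᶠ x in atTop, g ((x + logStep a α x) ^ 2) ≤ ρ * g (x ^ 2)) :
    ∀ᶠ x₁ in atTop,
      ∫⁻ y in Ici (x₁ ^ 2), ENNReal.ofReal (Real.exp (√y / Real.log √y)) ∂μ < ⊤ := by
  set d : ℝ → ℝ := fun x => (a * (α * Real.log x ^ (α - 1)) + (Real.log x)⁻¹) * x⁻¹ with hd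
  have hlim : Tendsto (fun x => Real.exp (logStep a α x / Real.log x) *
      (|(1 + logStep a α x / x) * (1 + d x)| * ρ)) atTop (nhds ρ) := by
    have := (tendsto_logStep_div_log (a := a) hα.2).rexp.mul
      ((((tendsto_logStep_div (a := a) hα.2).const_add 1).mul
        ((tendsto_deriv_logStep (a := a) hα.2).const_add 1)).abs.mul_const ρ)
    simpa using this
  obtain ⟨κ, hρκ, hκ⟩ := exists_between hρ
  obtain ⟨X, hX⟩ := eventually_atTop.1 ((hlim.eventually (gt_mem_nhds hρκ)).and hratio)
  filter_upwards [eventually_ge_atTop X, eventually_ge_atTop (Real.exp 1), eventually_ge_atTop x₀]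
    with x₁ hx₁X hx₁e hx₁0
  have hx₁1 : 1 < x₁ := (Real.one_lt_exp_iff.2 one_pos).trans_le hx₁e
  have hx₁ : 0 ≤ x₁ := by linarith
  have hsub : Ici (x₁ ^ 2) ⊆ Ici x₀ := Ici_subset_Ici.2 (by nlinarith)
  have hsq : ∀ y ∈ Ici (x₁ ^ 2), x₁ ≤ √y := fun y hy => Real.le_sqrt_of_sq_le hy
  have hexp : ∀ y ∈ Ici (x₁ ^ 2), Real.exp 1 ≤ √y := fun y hy => hx₁e.trans (hsq y hy)
  have hlog : ∀ x, Real.exp 1 ≤ x → 1 ≤ Real.log x := fun x hx =>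
    (Real.le_log_iff_exp_le ((Real.exp_pos 1).trans_le hx)).2 hx
  have hstep : ∀ y ∈ Ici (x₁ ^ 2), 0 ≤ logStep a α √y := fun y hy =>
    logStep_nonneg ha.le (hexp y hy)
  set S : ℝ → ℝ := fun y => (√y + logStep a α √y) ^ 2 with hSdef
  have hsqrtS : ∀ y ∈ Ici (x₁ ^ 2), √(S y) = √y + logStep a α √y := fun y hy =>
    Real.sqrt_sq (add_nonneg (Real.sqrt_nonneg y) (hstep y hy))
  have hyS : ∀ y ∈ Ici (x₁ ^ 2), y ≤ S y := by
    intro y hy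
    have hy0 : 0 ≤ y := (sq_nonneg x₁).trans hy
    calc y = √y ^ 2 := (Real.sq_sqrt hy0).symm
      _ ≤ S y := pow_le_pow_left₀ (Real.sqrt_nonneg y) (by linarith [hstep y hy]) 2
  refine setLIntegral_Ici_lt_top_of_contraction (g := g) (S := S)
    (S' := fun y => (1 + logStep a α √y / √y) * (1 + d √y))
    (w := fun y => Real.exp (logStep a α √y / Real.log √y)) (κ := κ)
    (B := Real.exp √(S (x₁ ^ 2)))
    hg_meas (by fun_prop) ?_ (fun y hy => (hg_pos y (hsub hy)).le) (fun y => (Real.exp_pos _).le)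
    ?_ ?_ ?_ (hyS _ self_mem_Ici) ?_ ?_ hκ (hρ0.trans hρκ.le) ?_ ?_
  · rw [← Measure.restrict_restrict_of_subset hsub, hg_ac, restrict_withDensity measurableSet_Ici,
      Measure.restrict_restrict_of_subset hsub]
  · intro y hy
    have hpos : 0 < √y := (Real.exp_pos 1).trans_le (hexp y hy)
    have h1 := Real.hasDerivAt_sqrt (Real.sqrt_pos.1 hpos).ne'
    have h2 := (h1.add ((hasDerivAt_logStep (a := a) (α := α) (hexp y hy)).comp y h1)).pow 2
    refine h2.congr_deriv ?_
    simp only [hd, Pi.add_apply, Function.comp, Nat.cast_ofNat, Nat.add_one_sub_one, pow_one]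
    generalize a * (α * Real.log √y ^ (α - 1)) + (Real.log √y)⁻¹ = q
    field_simp
  · intro y hy z hz hyz
    have h1 : √y < √z := Real.sqrt_lt_sqrt ((sq_nonneg x₁).trans hy) hyz
    have h2 := logStep_monotoneOn ha.le hα.1 (hexp y hy) (hexp z hz) h1.le
    exact pow_lt_pow_left₀ (by linarith) (add_nonneg (Real.sqrt_nonneg y) (hstep y hy)) two_ne_zero
  · refine tendsto_atTop_mono' _ ?_ tendsto_id
    filter_upwards [eventually_ge_atTop (x₁ ^ 2)] with y hy using hyS y hy
  · intro y hy
    have := hlog _ (hexp y hy)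
    exact Real.one_le_exp (div_nonneg (hstep y hy) (by linarith))
  · intro y hy
    have h1 := hlog _ (hexp y hy)
    have h2 := hstep y hy
    rw [hsqrtS y hy, ← Real.exp_add]
    refine Real.exp_le_exp.2 ?_
    rw [← add_div, add_comm (logStep a α √y)]
    have h3 : Real.log √y ≤ Real.log (√y + logStep a α √y) :=
      Real.log_le_log ((Real.exp_pos 1).trans_le (hexp y hy)) (by linarith)
    have h4 := Real.sqrt_nonneg y
    gcongr
  · intro y hy
    obtain ⟨h1, h2⟩ := hX √y (hx₁X.trans (hsq y hy))
    rw [Real.sq_sqrt ((sq_nonneg x₁).trans hy)] at h2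
    have hgy := (hg_pos y (hsub hy)).le
    calc _ ≤ Real.exp (logStep a α √y / Real.log √y) *
          (|(1 + logStep a α √y / √y) * (1 + d √y)| * (ρ * g y)) := by gcongr
      _ = Real.exp (logStep a α √y / Real.log √y) *
          (|(1 + logStep a α √y / √y) * (1 + d √y)| * ρ) * g y := by ring
      _ ≤ κ * g y := by gcongr
  · intro y hy
    refine Real.exp_le_exp.2 ((div_le_self (Real.sqrt_nonneg y) (hlog _ (hexp y hy.1))).trans ?_)
    exact Real.sqrt_le_sqrt hy.2

/-- Exponential integrability at scale `√y / log √y` bounds the moments by `logWeight`. -/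
theorem exists_sqrt_moment_le {μ : Measure ℝ} [IsProbabilityMeasure μ]
    (hmom : ∀ n : ℕ, Integrable (fun x => x ^ n) μ)
    (h : ∀ᶠ x₁ in atTop,
      ∫⁻ y in Ici (x₁ ^ 2), ENNReal.ofReal (Real.exp (√y / Real.log √y)) ∂μ < ⊤) :
    ∃ C : ℝ, ∀ n : ℕ, ∫ x, √x ^ n ∂μ ≤ C * logWeight n := by
  obtain ⟨X, hX⟩ := eventually_atTop.1 pow_le_exp_div_log_mul_logWeight
  obtain ⟨x₁, hx₁, hx₁X, hx₁0⟩ :=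
    (h.and ((eventually_ge_atTop X).and (eventually_ge_atTop 0))).exists
  set Φ : ℝ → ℝ := fun y => Real.exp (√y / Real.log √y) with hΦ
  have hΦm : Measurable Φ := by fun_prop
  have hint : IntegrableOn Φ (Ici (x₁ ^ 2)) μ :=
    (lintegral_ofReal_ne_top_iff_integrable hΦm.aestronglyMeasurable
      (ae_of_all _ fun y => (Real.exp_pos _).le)).1 hx₁.ne
  have hind : Integrable ((Ici (x₁ ^ 2)).indicator Φ) μ :=
    hint.integrable_indicator measurableSet_Ici
  refine ⟨Real.exp x₁ + ∫ y, (Ici (x₁ ^ 2)).indicator Φ y ∂μ, fun n => ?_⟩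
  have hw := one_le_logWeight n
  calc ∫ y, √y ^ n ∂μ
      ≤ ∫ y, (Real.exp x₁ + (Ici (x₁ ^ 2)).indicator Φ y) * logWeight n ∂μ := by
        refine integral_mono (integrable_sqrt_pow hmom n)
          (((integrable_const _).add hind).mul_const _) fun y => ?_
        by_cases hy : y ∈ Ici (x₁ ^ 2)
        · simp only [indicator_of_mem hy]
          have h1 := hX √y (hx₁X.trans (Real.le_sqrt_of_sq_le hy)) n
          have h2 : 0 ≤ Real.exp x₁ * logWeight n := by positivity
          rw [add_mul]
          linarith
        · simp only [indicator_of_notMem hy, add_zero]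
          have h1 : √y ≤ x₁ := Real.sqrt_le_iff.2 ⟨hx₁0, (not_le.1 hy).le⟩
          exact (pow_le_pow_left₀ (Real.sqrt_nonneg y) h1 n).trans
            (pow_le_exp_mul_logWeight hx₁0 n)
    _ = _ := by
        rw [integral_mul_const, integral_add (integrable_const _) hind]
        simp

/-- Corollary 5: if `limsup_{x→∞} g((x + a (log x)^α + log log x)²)/g(x²) < 1`
with `a > 0`, `α ∈ [0,1)`, `x₀ > e`, then `G` is M-det on `[0,∞)`. -/
theorem corollary5
    (x₀ : ℝ) (hx₀ : Real.exp 1 < x₀)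
    (a α : ℝ) (ha : 0 < a) (hα : α ∈ Ico (0 : ℝ) 1)
    (μ : Measure ℝ) [IsProbabilityMeasure μ]
    (hsupp : μ (Iio 0) = 0)
    (hmom : ∀ n : ℕ, Integrable (fun x => x ^ n) μ)
    (g : ℝ → ℝ) (hg_meas : Measurable g)
    (hg_ac : μ.restrict (Ici x₀) =
      (volume.restrict (Ici x₀)).withDensity (fun x => ENNReal.ofReal (g x)))
    (hg_pos : ∀ x ∈ Ici x₀, 0 < g x)
    (hlimsup : Filter.limsup
        (fun x => ENNReal.ofReal
          (g ((x + a * (Real.log x) ^ α + Real.log (Real.log x)) ^ 2) / g (x ^ 2)))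
        atTop < 1) :
    IsMomentDetOnNonneg μ := by
  obtain ⟨r, hr, hr1⟩ := exists_between hlimsup
  have hrtop : r ≠ ⊤ := hr1.ne_top
  have hratio : ∀ᶠ x in atTop, g ((x + logStep a α x) ^ 2) ≤ r.toReal * g (x ^ 2) := by
    filter_upwards [eventually_lt_of_limsup_lt hr, eventually_ge_atTop x₀] with x hx hxx₀
    have hx1 : 1 < x := (Real.one_lt_exp_iff.2 one_pos).trans (hx₀.trans_le hxx₀)
    have hpos : 0 < g (x ^ 2) := hg_pos _ (show x₀ ≤ x ^ 2 by nlinarith)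
    have hlt := (ENNReal.ofReal_le_iff_le_toReal hrtop).1 hx.le
    rw [logStep, ← add_assoc]
    exact (div_le_iff₀ hpos).1 hlt
  have hρ : r.toReal < 1 := by
    simpa using (ENNReal.toReal_lt_toReal hrtop ENNReal.one_ne_top).2 hr1
  obtain ⟨C, hC⟩ := exists_sqrt_moment_le hmom
    (exists_lintegral_exp_sqrt_div_log_lt_top ha hα hg_meas hg_ac hg_pos hρ
      ENNReal.toReal_nonneg hratio)
  exact isMomentDetOnNonneg_of_sqrt_moment_le hsupp hmom hC
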